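/- arXiv:1407.0108 — 2 statements merged into one kernel-verified Lean document; each statement's English description precedes it below -/
import Mathlib

section
/- Let $T>0$, $\Lambda>0$ and $N>0$. Then for every $t\in[0,T]$, $$\frac{2\Lambda}{1-\frac{N-\Lambda}{N+\Lambda}e^{-2(T-t)}}\;\le\;\frac{e^{2T}}{\frac{1}{N+\Lambda}+\frac{T-t}{\Lambda}}.$$ -/
theorem stmt_2 (T Λ N : ℝ) (hT : 0 < T) (hΛ : 0 < Λ) (hN : 0 < N) :
    ∀ t ∈ Set.Icc (0 : ℝ) T,
      2 * Λ / (1 - (N - Λ) / (N + Λ) * Real.exp (-2 * (T - t))) ≤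
        Real.exp (2 * T) / (1 / (N + Λ) + (T - t) / Λ) := by
  rintro t ⟨h0, h1⟩
  have hs : 0 ≤ T - t := by linarith
  have hNL : 0 < N + Λ := by linarith
  have hE : 2 * (T - t) + 1 ≤ Real.exp (2 * (T - t)) := Real.add_one_le_exp _
  have hET : Real.exp (2 * (T - t)) ≤ Real.exp (2 * T) := Real.exp_le_exp.mpr (by linarith)
  have hmul : Real.exp (2 * (T - t)) * Real.exp (-2 * (T - t)) = 1 := by
    rw [← Real.exp_add]; ring_nf; exact Real.exp_zero
  have hq : (N - Λ) / (N + Λ) < 1 := by rw [div_lt_one hNL]; linarith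
  have hD2 : 0 < 1 / (N + Λ) + (T - t) / Λ := by positivity
  have hk : 2 * Λ * (1 / (N + Λ) + (T - t) / Λ) = 1 - (N - Λ) / (N + Λ) + 2 * (T - t) := by
    field_simp; ring
  have hEp := Real.exp_pos (2 * (T - t))
  have hED : Real.exp (2 * (T - t)) * (1 - (N - Λ) / (N + Λ) * Real.exp (-2 * (T - t)))
      = Real.exp (2 * (T - t)) - (N - Λ) / (N + Λ) := by
    linear_combination (-((N - Λ) / (N + Λ))) * hmul
  have hD1 : 0 < 1 - (N - Λ) / (N + Λ) * Real.exp (-2 * (T - t)) := by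
    refine pos_of_mul_pos_right (a := Real.exp (2 * (T - t))) ?_ hEp.le
    rw [hED]; linarith
  rw [div_le_div_iff₀ hD1 hD2, hk]
  have := mul_le_mul_of_nonneg_right hET hD1.le
  linarith
end

section
/- Let $T>0$, $\Lambda>0$ and $N>0$. Then for every $t\in[0,T)$, $$\frac{2\Lambda}{1-\frac{N-\Lambda}{N+\Lambda}e^{-2(T-t)}}-\Lambda\;\le\;\frac{\Lambda e^{2T}}{T-t}.$$ In particular this upper bound is uniform in $N$. -/
theorem stmt_3 (T Λ N : ℝ) (hT : 0 < T) (hΛ : 0 < Λ) (hN : 0 < N) :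
    ∀ t ∈ Set.Ico (0 : ℝ) T,
      2 * Λ / (1 - (N - Λ) / (N + Λ) * Real.exp (-2 * (T - t))) - Λ ≤
        Λ * Real.exp (2 * T) / (T - t) := by
  rintro t ⟨ht0, htT⟩
  have hs : 0 < T - t := by linarith
  have hq : (N - Λ) / (N + Λ) ≤ 1 := by
    rw [div_le_one (by linarith)]; linarith
  have hF : 2 * (T - t) + 1 ≤ Real.exp (2 * (T - t)) := Real.add_one_le_exp _
  have hFT : Real.exp (2 * (T - t)) ≤ Real.exp (2 * T) := Real.exp_le_exp.mpr (by linarith)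
  have hEF : Real.exp (-2 * (T - t)) * Real.exp (2 * (T - t)) = 1 := by
    rw [← Real.exp_add]; simp
  have hE0 : 0 < Real.exp (-2 * (T - t)) := Real.exp_pos _
  have hE1 : Real.exp (-2 * (T - t)) < 1 := by rw [← Real.exp_zero]; exact Real.exp_lt_exp.mpr (by linarith)
  generalize Real.exp (-2 * (T - t)) = E at *
  generalize Real.exp (2 * (T - t)) = F at *
  generalize Real.exp (2 * T) = G at *
  generalize T - t = s at *
  have hqE : (N - Λ) / (N + Λ) * E ≤ E := mul_le_of_le_one_left hE0.le hq
  have h1 : 2 * Λ / (1 - (N - Λ) / (N + Λ) * E) ≤ 2 * Λ / (1 - E) :=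
    div_le_div_of_nonneg_left (by linarith) (by linarith) (by linarith)
  have key : 2 * s ≤ (s + G) * (1 - E) := by
    nlinarith [mul_pos hs (sub_pos.mpr hE1),
      mul_nonneg (sub_nonneg.mpr hFT) (sub_pos.mpr hE1).le]
  have h2 : 2 * Λ / (1 - E) ≤ Λ + Λ * G / s := by
    have h3 : Λ + Λ * G / s = Λ * (s + G) / s := by field_simp
    rw [h3, div_le_div_iff₀ (by linarith) hs]
    nlinarith [mul_le_mul_of_nonneg_left key hΛ.le]
  linarith
end
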